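/- arXiv:cs/0212055 — 4 statements merged into one kernel-verified Lean document; each statement's English description precedes it below -/
import Mathlib

section
/- Let p and q be distinct odd primes, let n = p·q, and let r and y be integers with gcd(r, n) = 1, y² ≡ r² (mod n), y ≢ r (mod n), and y ≢ −r (mod n). Then gcd(r − y, n) is a nontrivial factor of n; that is, gcd(r − y, n) equals p or equals q. -/
/-- Rabin's reduction, key step: if `y² ≡ r² (mod n)` for `n = p·q` a product of two
distinct odd primes, with `gcd(r, n) = 1`, `y ≢ r (mod n)` and `y ≢ -r (mod n)`,
then `gcd(r - y, n)` is a nontrivial factor of `n`, i.e. it equals `p` or `q`. -/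
theorem stmt_0 (p q : ℕ) (hp : p.Prime) (hq : q.Prime) (hpodd : Odd p) (hqodd : Odd q)
    (hpq : p ≠ q) (n : ℕ) (hn : n = p * q) (r y : ℤ)
    (hr : Int.gcd r (n : ℤ) = 1)
    (hsq : y ^ 2 ≡ r ^ 2 [ZMOD n])
    (h1 : ¬ (y ≡ r [ZMOD n]))
    (h2 : ¬ (y ≡ -r [ZMOD n])) :
    Int.gcd (r - y) (n : ℤ) = p ∨ Int.gcd (r - y) (n : ℤ) = q := by
  have hdvd : (n : ℤ) ∣ (r - y) * (r + y) := by
    have h := hsq.dvd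
    rwa [sq_sub_sq, mul_comm] at h
  have hd : Int.gcd (r - y) (n : ℤ) ∣ p * q := by
    rw [← hn]
    exact_mod_cast Int.gcd_dvd_right (r - y) (n : ℤ)
  obtain ⟨a, b, ha, hb, hab⟩ := (Nat.dvd_mul).1 hd
  rcases (Nat.dvd_prime hp).1 ha with rfl | rfl <;> rcases (Nat.dvd_prime hq).1 hb with rfl | rfl
  · refine absurd ?_ h2
    have hcop : IsCoprime (n : ℤ) (r - y) :=
      (Int.isCoprime_iff_gcd_eq_one.2 (by simpa using hab.symm)).symm
    refine (Int.modEq_iff_dvd.2 ?_).symm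
    simpa [add_comm] using hcop.dvd_of_dvd_mul_left hdvd
  · right
    simpa using hab.symm
  · left
    simpa using hab.symm
  · refine absurd (Int.modEq_iff_dvd.2 ?_) h1
    have h := Int.gcd_dvd_left (r - y) (n : ℤ)
    rwa [← hab, ← hn] at h
end

section
/- Let p and q be distinct primes with p ≡ 3 (mod 4) and q ≡ 3 (mod 4), and let n = p·q. Then the squaring map x ↦ x² restricted to the set S of squares in the unit group (Z/nZ)* is a bijection from S onto S. -/
theorem ZMod.sq_eq_one_of_pow_four_eq_one {p : ℕ} (hp : p.Prime) (hp4 : p % 4 = 3)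
    {z : ZMod p} (hz : z ^ 4 = 1) : z ^ 2 = 1 := by
  have : Fact p.Prime := ⟨hp⟩
  have h : (z ^ 2 - 1) * (z ^ 2 + 1) = 0 := by linear_combination hz
  rcases mul_eq_zero.mp h with h | h
  · exact sub_eq_zero.mp h
  · exact absurd hp4 (ZMod.mod_four_ne_three_of_sq_eq_neg_one (eq_neg_of_add_eq_zero_left h))

theorem ZMod.sq_eq_one_of_pow_four_eq_one_of_mul {p q : ℕ} (hp : p.Prime) (hq : q.Prime)
    (hp4 : p % 4 = 3) (hq4 : q % 4 = 3) (hpq : p ≠ q)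
    {z : ZMod (p * q)} (hz : z ^ 4 = 1) : z ^ 2 = 1 := by
  let e := ZMod.chineseRemainder ((Nat.coprime_primes hp hq).mpr hpq)
  have he : e z ^ 4 = 1 := by rw [← map_pow, hz, map_one]
  apply e.injective
  rw [map_pow, map_one]
  exact Prod.ext (ZMod.sq_eq_one_of_pow_four_eq_one hp hp4 (congrArg Prod.fst he))
    (ZMod.sq_eq_one_of_pow_four_eq_one hq hq4 (congrArg Prod.snd he))

/-- If every fourth root of unity in a finite commutative group squares to `1`, then squaring
permutes the squares. -/
theorem bijOn_sq_setOf_isSquare {G : Type*} [CommGroup G] [Finite G]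
    (h : ∀ z : G, z ^ 4 = 1 → z ^ 2 = 1) :
    Set.BijOn (fun x : G => x ^ 2) {x : G | IsSquare x} {x : G | IsSquare x} := by
  have hmaps : Set.MapsTo (fun x : G => x ^ 2) {x : G | IsSquare x} {x : G | IsSquare x} :=
    fun x _ => IsSquare.sq x
  refine ((Set.toFinite _).injOn_iff_bijOn_of_mapsTo hmaps).mp ?_
  rintro _ ⟨a, rfl⟩ _ ⟨b, rfl⟩ hab
  have hz : (a / b) ^ 4 = 1 := by
    rw [div_pow, div_eq_one]
    simpa only [← pow_two, ← pow_mul, Nat.reducePow] using hab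
  have hsq := h _ hz
  rwa [div_pow, div_eq_one, pow_two, pow_two] at hsq

/-- Williams' observation: for `n = p·q` with `p ≡ q ≡ 3 (mod 4)` distinct primes, the
squaring map restricted to the set of squares in the unit group `(ZMod n)ˣ` is a
bijection of that set onto itself. -/
theorem stmt_4 (p q : ℕ) (hp : p.Prime) (hq : q.Prime)
    (hp4 : p % 4 = 3) (hq4 : q % 4 = 3) (hpq : p ≠ q) :
    Set.BijOn (fun x : (ZMod (p * q))ˣ => x ^ 2)
      {x : (ZMod (p * q))ˣ | IsSquare x} {x : (ZMod (p * q))ˣ | IsSquare x} := by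
  have : NeZero (p * q) := ⟨mul_ne_zero hp.ne_zero hq.ne_zero⟩
  refine bijOn_sq_setOf_isSquare fun z hz => Units.ext ?_
  rw [Units.val_pow_eq_pow_val, Units.val_one]
  refine ZMod.sq_eq_one_of_pow_four_eq_one_of_mul hp hq hp4 hq4 hpq ?_
  rw [← Units.val_pow_eq_pow_val, hz, Units.val_one]
end

section
/- Let p and q be distinct odd primes, let n = p·q, and let A be any function from the unit group (Z/nZ)* to itself such that (A(x²))² = x² for every unit x (so A inverts the squaring map on squares). Then the number of units r in (Z/nZ)* satisfying A(r²) ≠ r and A(r²) ≠ −r is exactly half of the order of (Z/nZ)*. -/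
/-- In a finite commutative group with negation whose square roots of `1` are exactly the four
distinct elements `±1, ±w`, a square-root extractor returns a root of `r ^ 2` other than `±r` for
exactly half of all `r`. -/
theorem two_mul_card_sqrt_ne_of_involution {G : Type*} [CommGroup G] [HasDistribNeg G] [Finite G]
    (w : G) (hw : w ^ 2 = 1) (hw1 : w ≠ 1) (hw2 : w ≠ -1)
    (hall : ∀ x : G, x ^ 2 = 1 → x = 1 ∨ x = -1 ∨ x = w ∨ x = -w)
    (A : G → G) (hA : ∀ x : G, (A (x ^ 2)) ^ 2 = x ^ 2) :
    2 * Nat.card {r : G // A (r ^ 2) ≠ r ∧ A (r ^ 2) ≠ -r} = Nat.card G := by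
  classical
  have key : ∀ r : G, (A (r ^ 2) ≠ r ∧ A (r ^ 2) ≠ -r) ↔
      ¬ (A ((w * r) ^ 2) ≠ w * r ∧ A ((w * r) ^ 2) ≠ -(w * r)) := by
    intro r
    rw [mul_pow, hw, one_mul, not_and_or, not_not, not_not]
    constructor
    · rintro ⟨h1, h2⟩
      have h : (A (r ^ 2) * r⁻¹) ^ 2 = 1 := by rw [mul_pow, hA, inv_pow, mul_inv_cancel]
      rcases hall _ h with h | h | h | h <;> rw [mul_inv_eq_iff_eq_mul] at h
      · exact absurd (by simpa using h) h1
      · exact absurd (by simpa using h) h2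
      · exact Or.inl h
      · exact Or.inr (by simpa using h)
    · have h1 : w * r ≠ r := fun h => hw1 (mul_eq_right.mp h)
      have h2 : w * r ≠ -r := fun h => hw2 (mul_right_cancel (b := r) (by simpa using h))
      rintro (h | h) <;> rw [h]
      · exact ⟨h1, h2⟩
      · exact ⟨fun h' => h2 (neg_eq_iff_eq_neg.mp h'), fun h' => h1 (neg_injective h')⟩
  rw [← Nat.card_congr (Equiv.sumCompl fun r : G => A (r ^ 2) ≠ r ∧ A (r ^ 2) ≠ -r),
    Nat.card_sum, two_mul]
  congr 1
  exact Nat.card_congr ((Equiv.mulLeft w).subtypeEquiv key)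

/-- The square roots of `1` modulo a product of two distinct odd primes are four distinct units
`±1, ±w`. -/
theorem ZMod.exists_unit_involution {p q : ℕ} (hp : p.Prime) (hq : q.Prime) (hpodd : Odd p)
    (hqodd : Odd q) (hpq : p ≠ q) :
    ∃ w : (ZMod (p * q))ˣ, w ^ 2 = 1 ∧ w ≠ 1 ∧ w ≠ -1 ∧
      ∀ x : (ZMod (p * q))ˣ, x ^ 2 = 1 → x = 1 ∨ x = -1 ∨ x = w ∨ x = -w := by
  have := Fact.mk hp
  have := Fact.mk hq
  have : Fact (2 < p) := ⟨hp.two_le.lt_of_ne (by rintro rfl; exact absurd hpodd (by decide))⟩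
  have : Fact (2 < q) := ⟨hq.two_le.lt_of_ne (by rintro rfl; exact absurd hqodd (by decide))⟩
  let e := ZMod.chineseRemainder ((Nat.coprime_primes hp hq).mpr hpq)
  have hmul : e.symm (1, -1) * e.symm (1, -1) = 1 := by
    rw [← map_mul, Prod.mk_mul_mk, one_mul, neg_mul_neg, one_mul]
    exact map_one e.symm
  refine ⟨⟨e.symm (1, -1), e.symm (1, -1), hmul, hmul⟩, ?_, ?_, ?_, ?_⟩
  · ext
    simpa [sq] using hmul
  · intro h
    have h' := congrArg (fun u : (ZMod (p * q))ˣ => (e u).2) h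
    simp [ZMod.neg_one_ne_one] at h'
  · intro h
    have h' := congrArg (fun u : (ZMod (p * q))ˣ => (e u).1) h
    simp [ZMod.neg_one_ne_one.symm] at h'
  · intro x hx
    have hx' : e x ^ 2 = 1 := by
      rw [← map_pow, ← Units.val_pow_eq_pow_val, hx, Units.val_one, map_one]
    have h1 : (e x).1 = 1 ∨ (e x).1 = -1 := sq_eq_one_iff.mp (congrArg Prod.fst hx')
    have h2 : (e x).2 = 1 ∨ (e x).2 = -1 := sq_eq_one_iff.mp (congrArg Prod.snd hx')
    simp only [Units.ext_iff, ← e.injective.eq_iff, Prod.ext_iff]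
    rcases h1 with h1 | h1 <;> rcases h2 with h2 | h2 <;> simp [h1, h2]

/-- Success-probability analysis of Rabin's reduction: for `n = p·q` a product of two
distinct odd primes and any square-root extractor `A` on the unit group `(ZMod n)ˣ`
(i.e. `(A (x²))² = x²` for every unit `x`), exactly half of the units `r` satisfy
`A (r²) ≠ r` and `A (r²) ≠ -r`. -/
theorem stmt_8 (p q : ℕ) (hp : p.Prime) (hq : q.Prime) (hpodd : Odd p) (hqodd : Odd q)
    (hpq : p ≠ q) (A : (ZMod (p * q))ˣ → (ZMod (p * q))ˣ)
    (hA : ∀ x : (ZMod (p * q))ˣ, (A (x ^ 2)) ^ 2 = x ^ 2) :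
    2 * Nat.card {r : (ZMod (p * q))ˣ // A (r ^ 2) ≠ r ∧ A (r ^ 2) ≠ -r} =
      Nat.card (ZMod (p * q))ˣ := by
  have : NeZero (p * q) := ⟨mul_ne_zero hp.ne_zero hq.ne_zero⟩
  obtain ⟨w, hw, hw1, hw2, hall⟩ := ZMod.exists_unit_involution hp hq hpodd hqodd hpq
  exact two_mul_card_sqrt_ne_of_involution w hw hw1 hw2 hall A hA
end

section
/- Let k be a natural number, let ε > 0 be a real number, and let f be any function from (Z/2Z)^k to Z/2Z. Then the number of vectors a ∈ (Z/2Z)^k such that f agrees with the linear function x ↦ Σ_{i=1}^{k} a_i x_i (mod 2) on at least a (1/2 + ε) fraction of the 2^k inputs x is at most 1/(4ε²). -/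
/-- The nontrivial real character `z ↦ (-1)^z` of `ZMod 2`. -/
noncomputable def signChar : AddChar (ZMod 2) ℝ :=
  AddChar.zmodChar 2 (ζ := -1) (by norm_num)

lemma signChar_eq_ite (z : ZMod 2) : signChar z = if z = 0 then 1 else -1 := by
  rw [signChar, AddChar.zmodChar_apply]
  obtain rfl | rfl : z = 0 ∨ z = 1 := by revert z; decide
  · simp
  · simp [ZMod.val_one]

lemma signChar_mul (u v : ZMod 2) : signChar u * signChar v = if u = v then 1 else -1 := by
  rw [← AddChar.map_add_eq_mul, signChar_eq_ite]
  simp only [CharTwo.add_eq_zero]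

lemma sum_signChar_mul (z : ZMod 2) : ∑ c, signChar (c * z) = if z = 0 then 2 else 0 := by
  have univ_eq : (Finset.univ : Finset (ZMod 2)) = {0, 1} := rfl
  simp only [signChar_eq_ite]
  obtain rfl | rfl : z = 0 ∨ z = 1 := by revert z; decide
  · norm_num
  · simp [univ_eq]

lemma signChar_sum {ι : Type*} (s : Finset ι) (z : ι → ZMod 2) :
    signChar (∑ i ∈ s, z i) = ∏ i ∈ s, signChar (z i) :=
  map_prod signChar.toMonoidHom (fun i => Multiplicative.ofAdd (z i)) s

/-- Orthogonality of the characters of `(ZMod 2)^k`. -/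
lemma sum_signChar_dotProduct {k : ℕ} (z : Fin k → ZMod 2) :
    ∑ a : Fin k → ZMod 2, signChar (∑ i, a i * z i) = if z = 0 then 2 ^ k else 0 := by
  simp only [signChar_sum]
  rw [← Fintype.prod_sum (fun i c => signChar (c * z i))]
  simp only [sum_signChar_mul]
  split_ifs with h
  · simp [h]
  · obtain ⟨i, hi⟩ := Function.ne_iff.mp h
    exact Finset.prod_eq_zero (Finset.mem_univ i) (if_neg hi)

/-- Parseval's identity for the Walsh–Hadamard transform of a Boolean function. -/
lemma sum_sq_walsh {k : ℕ} (f : (Fin k → ZMod 2) → ZMod 2) :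
    ∑ a : Fin k → ZMod 2, (∑ x, signChar (f x) * signChar (∑ i, a i * x i)) ^ 2
      = (2 ^ k) ^ 2 := by
  have expand (a : Fin k → ZMod 2) :
      (∑ x, signChar (f x) * signChar (∑ i, a i * x i)) ^ 2 =
        ∑ x, ∑ y, signChar (f x) * signChar (f y) * signChar (∑ i, a i * (x + y) i) := by
    rw [sq, Finset.sum_mul_sum]
    refine Finset.sum_congr rfl fun x _ => Finset.sum_congr rfl fun y _ => ?_
    simp only [Pi.add_apply, mul_add, Finset.sum_add_distrib, AddChar.map_add_eq_mul]
    ring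
  simp only [expand]
  rw [Finset.sum_comm]
  have inner (x : Fin k → ZMod 2) :
      ∑ a : Fin k → ZMod 2, ∑ y,
        signChar (f x) * signChar (f y) * signChar (∑ i, a i * (x + y) i) = 2 ^ k := by
    rw [Finset.sum_comm]
    have add_eq_zero (y : Fin k → ZMod 2) : x + y = 0 ↔ x = y := by
      simp [funext_iff, CharTwo.add_eq_zero]
    simp only [← Finset.mul_sum, sum_signChar_dotProduct, add_eq_zero]
    simp [signChar_mul]
  simp only [inner]
  simp [sq]

/-- The Walsh coefficient at `a` counts agreements minus disagreements. -/
lemma walsh_eq_two_mul_card_sub {k : ℕ} (f : (Fin k → ZMod 2) → ZMod 2) (a : Fin k → ZMod 2) :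
    ∑ x, signChar (f x) * signChar (∑ i, a i * x i) =
      2 * (Nat.card {x : Fin k → ZMod 2 // f x = ∑ i, a i * x i} : ℝ) - 2 ^ k := by
  have h (x : Fin k → ZMod 2) : signChar (f x) * signChar (∑ i, a i * x i) =
      2 * (if f x = ∑ i, a i * x i then 1 else 0) - 1 := by
    rw [signChar_mul]
    split_ifs <;> norm_num
  simp only [h, Finset.sum_sub_distrib, ← Finset.mul_sum]
  simp [Fintype.card_subtype]

/-- Goldreich–Levin list-size bound: for any `f : (Z/2Z)^k → Z/2Z` and `ε > 0`, the
number of linear functions `x ↦ Σ aᵢxᵢ` agreeing with `f` on at least a `(1/2 + ε)`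
fraction of the `2^k` inputs is at most `1/(4ε²)`. -/
theorem stmt_13 (k : ℕ) (ε : ℝ) (hε : 0 < ε) (f : (Fin k → ZMod 2) → ZMod 2) :
    (Nat.card {a : Fin k → ZMod 2 //
        ((1 : ℝ) / 2 + ε) * 2 ^ k ≤
          Nat.card {x : Fin k → ZMod 2 // f x = ∑ i, a i * x i}} : ℝ) ≤
      1 / (4 * ε ^ 2) := by
  classical
  rw [Nat.card_eq_fintype_card, Fintype.card_subtype]
  set A := Finset.univ.filter fun a : Fin k → ZMod 2 =>
    ((1 : ℝ) / 2 + ε) * 2 ^ k ≤ Nat.card {x : Fin k → ZMod 2 // f x = ∑ i, a i * x i} with hA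
  have hpos : (0 : ℝ) < 2 ^ k := by positivity
  have large : ∀ a ∈ A, (2 * ε * 2 ^ k) ^ 2 ≤
      (∑ x, signChar (f x) * signChar (∑ i, a i * x i)) ^ 2 := by
    intro a ha
    have ha' := (Finset.mem_filter.mp ha).2
    refine pow_le_pow_left₀ (by positivity) ?_ 2
    rw [walsh_eq_two_mul_card_sub]
    linarith
  have key : (A.card : ℝ) * (2 * ε * 2 ^ k) ^ 2 ≤ (2 ^ k) ^ 2 := by
    rw [← nsmul_eq_mul, ← sum_sq_walsh f]
    exact (Finset.card_nsmul_le_sum A _ _ large).trans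
      (Finset.sum_le_univ_sum_of_nonneg fun a => sq_nonneg _)
  rw [le_div_iff₀ (by positivity)]
  refine le_of_mul_le_mul_right ?_ (pow_pos hpos 2)
  linarith
end
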